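/- Let P = (P^{ij}) be an antisymmetric n×n matrix of entire functions on ℂⁿ and let α be a nowhere-vanishing entire function. Then the following are equivalent: (i) α is a holomorphic last multiplier for the holomorphic Poisson bivector P, i.e. Σ_{j=1}^n ∂(α·P^{ij})/∂z^j = 0 identically for every i = 1, …, n (equivalently D_{ω₀}(αP) = 0); (ii) the modular vector field of P with respect to the rescaled volume form α·ω₀ vanishes, i.e. for every entire function f one has div Z_f + (1/α)·Z_f(α) = 0 identically, where Z_f is the Hamiltonian vector field of f (equivalently, α is a holomorphic last multiplier for every holomorphic Hamiltonian vector field Z_f). -/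

import Mathlib

open scoped BigOperators

variable {n : ℕ}

/-- Partial derivative ∂f/∂z^i of a function on ℂⁿ. -/
noncomputable def pd (f : (Fin n → ℂ) → ℂ) (i : Fin n) (z : Fin n → ℂ) : ℂ :=
  fderiv ℂ f z (Pi.single i 1)

/-- Holomorphic divergence div Z = Σ_k ∂Z^k/∂z^k. -/
noncomputable def hdiv (Z : (Fin n → ℂ) → (Fin n → ℂ)) (z : Fin n → ℂ) : ℂ :=
  ∑ k, pd (fun w => Z w k) k z

/-- Holomorphic last multiplier: Z(α) + α · div Z = 0. -/
def IsHLM (Z : (Fin n → ℂ) → (Fin n → ℂ)) (α : (Fin n → ℂ) → ℂ) : Prop :=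
  ∀ z, (∑ k, Z z k * pd α k z) + α z * hdiv Z z = 0

/-- Real divergence: trace over ℝ of the real Fréchet derivative. -/
noncomputable def rdiv (X : (Fin n → ℂ) → (Fin n → ℂ)) (z : Fin n → ℂ) : ℝ :=
  LinearMap.trace ℝ (Fin n → ℂ) (fderiv ℝ X z : (Fin n → ℂ) →ₗ[ℝ] (Fin n → ℂ))

/-- Real last multiplier: (Dᵣu)(X) + u · divᵣ X = 0. -/
def IsRLM (X : (Fin n → ℂ) → (Fin n → ℂ)) (u : (Fin n → ℂ) → ℝ) : Prop :=
  ∀ z, fderiv ℝ u z (X z) + u z * rdiv X z = 0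

/-- ∂u/∂x^i for real-valued u. -/
noncomputable def px (u : (Fin n → ℂ) → ℝ) (i : Fin n) (z : Fin n → ℂ) : ℝ :=
  fderiv ℝ u z (Pi.single i 1)

/-- ∂u/∂x^{n+i} for real-valued u. -/
noncomputable def py (u : (Fin n → ℂ) → ℝ) (i : Fin n) (z : Fin n → ℂ) : ℝ :=
  fderiv ℝ u z (Pi.single i Complex.I)

/-- Lie bracket of two vector fields. -/
noncomputable def lie (Z W : (Fin n → ℂ) → (Fin n → ℂ)) (z : Fin n → ℂ) : Fin n → ℂ :=
  fderiv ℂ W z (Z z) - fderiv ℂ Z z (W z)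

/-- Holomorphic Laplacian Δu = Σ_i ∂²u/∂(z^i)². -/
noncomputable def lap (f : (Fin n → ℂ) → ℂ) (z : Fin n → ℂ) : ℂ :=
  ∑ i, pd (pd f i) i z

theorem pd_mul {f g : (Fin n → ℂ) → ℂ} {z : Fin n → ℂ} (hf : DifferentiableAt ℂ f z)
    (hg : DifferentiableAt ℂ g z) (i : Fin n) :
    pd (fun w => f w * g w) i z = f z * pd g i z + g z * pd f i z := by
  simp [pd, fderiv_fun_mul hf hg]

theorem pd_sum {ι : Type*} {s : Finset ι} {f : ι → (Fin n → ℂ) → ℂ} {z : Fin n → ℂ}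
    (hf : ∀ k ∈ s, DifferentiableAt ℂ (f k) z) (i : Fin n) :
    pd (fun w => ∑ k ∈ s, f k w) i z = ∑ k ∈ s, pd (f k) i z := by
  simp [pd, fderiv_fun_sum hf]

theorem AnalyticAt.pd {f : (Fin n → ℂ) → ℂ} {z : Fin n → ℂ} (hf : AnalyticAt ℂ f z)
    (i : Fin n) : AnalyticAt ℂ (pd f i) z :=
  ((ContinuousLinearMap.apply ℂ ℂ (Pi.single i 1 : Fin n → ℂ)).analyticAt _).comp hf.fderiv

theorem pd_pd_comm {f : (Fin n → ℂ) → ℂ} {z : Fin n → ℂ} (hf : AnalyticAt ℂ f z)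
    (i j : Fin n) : pd (pd f i) j z = pd (pd f j) i z := by
  have expand (k l : Fin n) :
      pd (pd f k) l z = fderiv ℂ (fderiv ℂ f) z (Pi.single l 1) (Pi.single k 1) := by
    change fderiv ℂ (fun w => fderiv ℂ f w (Pi.single k 1)) z (Pi.single l 1) = _
    rw [fderiv_clm_apply hf.fderiv.differentiableAt (differentiableAt_const _)]
    simp
  rw [expand, expand]
  exact (hf.contDiffAt (n := 2)).isSymmSndFDerivAt (by simp) _ _

/-- The contraction of an antisymmetric matrix with a symmetric one vanishes. -/
theorem sum_mul_eq_zero_of_antisymm_symm {ι : Type*} [Fintype ι] {A S : ι → ι → ℂ}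
    (hA : ∀ i j, A i j = -A j i) (hS : ∀ i j, S i j = S j i) :
    ∑ j, ∑ i, A i j * S i j = 0 := by
  refine self_eq_neg.mp ?_
  conv_lhs => rw [Finset.sum_comm]
  simp_rw [← Finset.sum_neg_distrib]
  refine Finset.sum_congr rfl fun i _ => Finset.sum_congr rfl fun j _ => ?_
  rw [hA, hS, neg_mul]

/-- The divergence of the Hamiltonian vector field of `f` only involves first derivatives
of `f`. -/
theorem hdiv_hamiltonian {P : (Fin n → ℂ) → Matrix (Fin n) (Fin n) ℂ} {z : Fin n → ℂ}
    (hP : ∀ i j, AnalyticAt ℂ (fun w => P w i j) z) (hPanti : ∀ i j, P z i j = -P z j i)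
    {f : (Fin n → ℂ) → ℂ} (hf : AnalyticAt ℂ f z) :
    hdiv (fun w j => ∑ i, P w i j * pd f i w) z =
      ∑ j, ∑ i, pd f i z * pd (fun w => P w i j) j z := by
  have expand (j : Fin n) : pd (fun w => ∑ i, P w i j * pd f i w) j z =
      ∑ i, (P z i j * pd (pd f i) j z + pd f i z * pd (fun w => P w i j) j z) := by
    rw [pd_sum fun i _ => (hP i j).differentiableAt.fun_mul (hf.pd i).differentiableAt]
    exact Finset.sum_congr rfl fun i _ =>
      pd_mul (hP i j).differentiableAt (hf.pd i).differentiableAt j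
  simp_rw [hdiv, expand, Finset.sum_add_distrib]
  rw [sum_mul_eq_zero_of_antisymm_symm hPanti (pd_pd_comm hf), zero_add]

/-- The divergence of the Hamiltonian vector field of `f` with respect to `α · ω₀` is, up to the
factor `α`, the curl of `α P` applied to `f`. -/
theorem mul_hdiv_hamiltonian_add {P : (Fin n → ℂ) → Matrix (Fin n) (Fin n) ℂ} {z : Fin n → ℂ}
    (hP : ∀ i j, AnalyticAt ℂ (fun w => P w i j) z) (hPanti : ∀ i j, P z i j = -P z j i)
    {α f : (Fin n → ℂ) → ℂ} (hα : AnalyticAt ℂ α z) (hα0 : α z ≠ 0) (hf : AnalyticAt ℂ f z) :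
    α z * (hdiv (fun w j => ∑ i, P w i j * pd f i w) z +
        (α z)⁻¹ * (∑ j, (∑ i, P z i j * pd f i z) * pd α j z)) =
      ∑ i, pd f i z * ∑ j, pd (fun w => α w * P w i j) j z := by
  rw [hdiv_hamiltonian hP hPanti hf, mul_add, mul_inv_cancel_left₀ hα0]
  simp_rw [pd_mul hα.differentiableAt (hP _ _).differentiableAt, Finset.mul_sum, Finset.sum_mul]
  conv_rhs => rw [Finset.sum_comm]
  simp_rw [← Finset.sum_add_distrib]
  refine Finset.sum_congr rfl fun j _ => Finset.sum_congr rfl fun i _ => ?_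
  ring

theorem pd_coord (i j : Fin n) (z : Fin n → ℂ) :
    pd (fun w => w i) j z = if j = i then 1 else 0 := by
  have h : fderiv ℂ (fun w : Fin n → ℂ => w i) z = ContinuousLinearMap.proj i :=
    (ContinuousLinearMap.proj (R := ℂ) (φ := fun _ : Fin n => ℂ) i).fderiv
  simp [pd, h, Pi.single_apply, eq_comm]

/-- A nowhere-vanishing entire α is a holomorphic last multiplier for the
bivector P (Σ_j ∂(αP^{ij})/∂z^j = 0 for all i) iff the modular vector field of P with respect
to α·ω₀ vanishes, i.e. for every entire f, div Z_f + (1/α)·Z_f(α) = 0. -/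
theorem last_multiplier_bivector_iff_modular_vanishes
    (P : (Fin n → ℂ) → Matrix (Fin n) (Fin n) ℂ)
    (hP : ∀ i j z, AnalyticAt ℂ (fun w => P w i j) z)
    (hPanti : ∀ z i j, P z i j = -P z j i)
    (α : (Fin n → ℂ) → ℂ) (hα : ∀ z, AnalyticAt ℂ α z) (hα0 : ∀ z, α z ≠ 0) :
    (∀ i z, (∑ j, pd (fun w => α w * P w i j) j z) = 0) ↔
      (∀ f : (Fin n → ℂ) → ℂ, (∀ z, AnalyticAt ℂ f z) →
        ∀ z, hdiv (fun w j => ∑ i, P w i j * pd f i w) z +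
          (α z)⁻¹ * (∑ j, (∑ i, P z i j * pd f i z) * pd α j z) = 0) := by
  constructor
  · intro h f hf z
    have key := mul_hdiv_hamiltonian_add (hP · · z) (hPanti z) (hα z) (hα0 z) (hf z)
    simp only [h, mul_zero, Finset.sum_const_zero] at key
    exact (mul_eq_zero.mp key).resolve_left (hα0 z)
  · intro h i z
    have hcoord (w : Fin n → ℂ) : AnalyticAt ℂ (fun w : Fin n → ℂ => w i) w :=
      (ContinuousLinearMap.proj (R := ℂ) (φ := fun _ : Fin n => ℂ) i).analyticAt w
    have key := mul_hdiv_hamiltonian_add (hP · · z) (hPanti z) (hα z) (hα0 z) (hcoord z)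
    rw [h _ hcoord z, mul_zero] at key
    simpa [pd_coord] using key.symm
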